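/- arXiv:1211.4321 — 4 statements merged into one kernel-verified Lean document; each statement's English description precedes it below -/
import Mathlib

section
/- Let (w_k)_{k∈ℕ} be strictly positive reals with ∑_{k=0}^∞ w_k < ∞, let ρ : {1,…,m} → ℕ be injective, let Z_1, …, Z_m > 0 and set z_{ρ(i)} = ∑_{j=1}^{i} Z_j. Then the infinite product ∏_{k ∉ range(ρ)} e^{−w_k z_{ρ(m)}} converges, and (∏_{i=1}^m w_{ρ(i)} e^{−w_{ρ(i)} z_{ρ(i)}}) · ∏_{k ∉ range(ρ)} e^{−w_k z_{ρ(m)}} = ∏_{i=1}^m w_{ρ(i)} · exp( −Z_i ( (∑_{k=0}^∞ w_k) − ∑_{j=1}^{i−1} w_{ρ(j)} ) ). -/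
/-- The sum of a summable family outside the range of an injective finite list. -/
theorem hasSum_compl_range_of_injective {α ι : Type*} [Fintype ι] {w : α → ℝ} (hw : Summable w)
    {ρ : ι → α} (hρ : Function.Injective ρ) :
    HasSum (fun k : {k : α // k ∉ Set.range ρ} => w k) ((∑' k, w k) - ∑ i, w (ρ i)) := by
  have hsum : HasSum (fun k : Set.range ρ => w k) (∑ i, w (ρ i)) := by
    rw [← (Equiv.ofInjective ρ hρ).hasSum_iff]
    exact hasSum_fintype _
  have htail : HasSum (fun k : {k : α // k ∉ Set.range ρ} => w k)
      (∑' k : {k : α // k ∉ Set.range ρ}, w k) := (hw.subtype {k | k ∉ Set.range ρ}).hasSum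
  have htotal : HasSum w (∑ i, w (ρ i) + ∑' k : {k : α // k ∉ Set.range ρ}, w k) :=
    hsum.add_compl htail
  rwa [htotal.tsum_eq, add_sub_cancel_left]

/-- Abel summation of the arrival-time exponents into inter-arrival exponents. -/
theorem sum_mul_sum_le_add_eq_sum_mul_sub_sum_lt {ι : Type*} [Fintype ι] [LinearOrder ι]
    (v Z : ι → ℝ) (W : ℝ) :
    ∑ i, v i * ∑ j ∈ Finset.univ.filter (fun j => j ≤ i), Z j + (W - ∑ i, v i) * ∑ j, Z j =
      ∑ i, Z i * (W - ∑ j ∈ Finset.univ.filter (fun j => j < i), v j) := by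
  have hsplit (i : ι) : ∑ j ∈ Finset.univ.filter (fun j => j < i), v j =
      ∑ j, v j - ∑ j ∈ Finset.univ.filter (fun j => i ≤ j), v j := by
    rw [← Finset.sum_filter_add_sum_filter_not Finset.univ (fun j => j < i) v]
    simp
  have hswap : ∑ i, v i * ∑ j ∈ Finset.univ.filter (fun j => j ≤ i), Z j =
      ∑ i, Z i * ∑ j ∈ Finset.univ.filter (fun j => i ≤ j), v j := by
    simp only [Finset.mul_sum, Finset.sum_filter]
    rw [Finset.sum_comm]
    exact Finset.sum_congr rfl fun i _ => Finset.sum_congr rfl fun j _ => by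
      split_ifs <;> ring
  simp_rw [hsplit, hswap, Finset.mul_sum, ← Finset.sum_add_distrib]
  refine Finset.sum_congr rfl fun i _ => ?_
  rw [← Finset.mul_sum]
  ring


/-- Joint density identity for the Thurstonian race representation of the infinite
Plackett-Luce model: for summable positive weights `(w_k)`, an injective top-`m` list
`ρ`, positive inter-arrival durations `Z_i` and arrival times `z_{ρ(i)} = ∑_{j≤i} Z_j`,
the infinite product `∏_{k ∉ range ρ} e^{-w_k z_{ρ(m)}}` converges and
`(∏_i w_{ρ(i)} e^{-w_{ρ(i)} z_{ρ(i)}}) ∏_{k ∉ range ρ} e^{-w_k z_{ρ(m)}}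
  = ∏_i w_{ρ(i)} exp(-Z_i ((∑_k w_k) - ∑_{j<i} w_{ρ(j)}))`. -/
theorem infinite_PL_density_regrouping (w : ℕ → ℝ) (hw : ∀ k, 0 < w k) (hsum : Summable w)
    {m : ℕ} (ρ : Fin m → ℕ) (hρ : Function.Injective ρ)
    (Z : Fin m → ℝ) (hZ : ∀ i, 0 < Z i) :
    Multipliable (fun k : {k : ℕ // k ∉ Set.range ρ} =>
        Real.exp (-(w k) * ∑ j : Fin m, Z j)) ∧
    (∏ i : Fin m, w (ρ i) *
          Real.exp (-(w (ρ i)) * ∑ j ∈ Finset.univ.filter (fun j => j ≤ i), Z j)) *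
        ∏' k : {k : ℕ // k ∉ Set.range ρ}, Real.exp (-(w k) * ∑ j : Fin m, Z j)
      = ∏ i : Fin m, w (ρ i) *
          Real.exp (-(Z i) *
            ((∑' k, w k) - ∑ j ∈ Finset.univ.filter (fun j => j < i), w (ρ j))) := by
  have hprod := ((hasSum_compl_range_of_injective hsum hρ).neg.mul_right
    (∑ j, Z j)).rexp
  simp only [Function.comp_def] at hprod
  refine ⟨hprod.multipliable, ?_⟩
  rw [hprod.tprod_eq]
  simp only [Finset.prod_mul_distrib, ← Real.exp_sum]
  rw [mul_assoc, ← Real.exp_add]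
  simp only [neg_mul, Finset.sum_neg_distrib, ← neg_add,
    sum_mul_sum_le_add_eq_sum_mul_sub_sum_lt (fun i => w (ρ i)) Z]
end

section
/- Let α > 0, τ > 0, φ > 0. Then for every w > 0, α w^{−1} e^{−(τ+φ)w} + ∑_{n=1}^∞ (α/n)·(φ/(τ+φ))^n · f_{n,τ+φ}(w) = α w^{−1} e^{−τw}, where f_{n,τ+φ}(w) = (τ+φ)^n w^{n−1} e^{−(τ+φ)w}/(n−1)! is the density of the Gamma distribution with shape n and rate τ+φ. -/
/-- The exponential series without its constant term sums to `exp x - 1`. -/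
theorem Real.hasSum_pow_succ_div_factorial (x : ℝ) :
    HasSum (fun n : ℕ => x ^ (n + 1) / (Nat.factorial (n + 1) : ℝ)) (Real.exp x - 1) := by
  have h := NormedSpace.expSeries_div_hasSum_exp x
  rw [← Real.exp_eq_exp_ℝ] at h
  simpa using (hasSum_nat_add_iff' 1).mpr h


/-- Stationarity of the Pitt–Walker construction, at the level of Lévy intensities:
for `α, τ, φ > 0` and `w > 0`,
`α w⁻¹ e^{-(τ+φ) w} + ∑_{n≥1} (α/n) (φ/(τ+φ))^n · f_{n, τ+φ}(w) = α w⁻¹ e^{-τ w}`,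
where `f_{n, τ+φ}(w) = (τ+φ)^n w^{n-1} e^{-(τ+φ) w} / (n-1)!` is the Gamma(n, τ+φ) density. -/
theorem pittWalker_intensity_stationarity (α τ φ : ℝ) (hα : 0 < α) (hτ : 0 < τ) (hφ : 0 < φ)
    (w : ℝ) (hw : 0 < w) :
    α * w⁻¹ * Real.exp (-(τ + φ) * w) +
        ∑' n : ℕ+, (α / (n : ℝ)) * (φ / (τ + φ)) ^ (n : ℕ) *
          ((τ + φ) ^ (n : ℕ) * w ^ ((n : ℕ) - 1) * Real.exp (-(τ + φ) * w) /
            Nat.factorial ((n : ℕ) - 1))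
      = α * w⁻¹ * Real.exp (-τ * w) := by
  have hne : τ + φ ≠ 0 := by positivity
  have hterm (n : ℕ) : (α / ((n + 1 : ℕ) : ℝ)) * (φ / (τ + φ)) ^ (n + 1) *
      ((τ + φ) ^ (n + 1) * w ^ (n + 1 - 1) * Real.exp (-(τ + φ) * w) /
        Nat.factorial (n + 1 - 1)) =
      α * w⁻¹ * Real.exp (-(τ + φ) * w) * ((φ * w) ^ (n + 1) / (Nat.factorial (n + 1) : ℝ)) := by
    rw [Nat.add_sub_cancel, Nat.factorial_succ, div_pow, mul_pow, pow_succ w]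
    push_cast
    field_simp
  rw [tsum_pnat_eq_tsum_succ (f := fun n : ℕ => (α / (n : ℝ)) * (φ / (τ + φ)) ^ n *
      ((τ + φ) ^ n * w ^ (n - 1) * Real.exp (-(τ + φ) * w) / Nat.factorial (n - 1)))]
  simp_rw [hterm]
  rw [tsum_mul_left, (Real.hasSum_pow_succ_div_factorial (φ * w)).tsum_eq,
    show -τ * w = -(τ + φ) * w + φ * w by ring, Real.exp_add]
  ring
end

section
/- Let α > 0, τ > 0, φ > 0. Then for every w' > 0, ∑_{c=0}^∞ ∫_0^∞ f_{α+c, τ+φ}(w') · e^{−φw}(φw)^c/c! · f_{α,τ}(w) dw = f_{α,τ}(w'), where f_{a,b}(w) = b^a w^{a−1} e^{−bw}/Γ(a) denotes the density of the Gamma distribution with shape a and rate b. -/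
open MeasureTheory

/-- The density of the Gamma distribution with shape `a` and rate `b`:
`f_{a,b}(w) = b^a w^{a-1} e^{-b w} / Γ(a)` (for `w > 0`). -/
noncomputable def gammaDensity (a b w : ℝ) : ℝ :=
  b ^ a * w ^ (a - 1) * Real.exp (-b * w) / Real.Gamma a

/-- In the Gamma-Poisson model, integrating out the previous
mass leaves a Poisson weight times the Gamma density. -/
lemma integral_gammaDensity_mul_poisson {α τ φ w' : ℝ} (hα : 0 < α) (hτ : 0 < τ) (hφ : 0 < φ)
    (hw' : 0 < w') (c : ℕ) :
    ∫ w in Set.Ioi (0 : ℝ),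
        gammaDensity (α + c) (τ + φ) w' * (Real.exp (-φ * w) * (φ * w) ^ c / Nat.factorial c) *
          gammaDensity α τ w
      = gammaDensity α τ w' * Real.exp (-φ * w') * ((φ * w') ^ c / Nat.factorial c) := by
  have hαc : 0 < α + c := by positivity
  have hr : 0 < τ + φ := by positivity
  have hΓ := (Real.Gamma_pos_of_pos hα).ne'
  have hΓc := (Real.Gamma_pos_of_pos hαc).ne'
  have hpow : (τ + φ) ^ (α + c) ≠ 0 := (Real.rpow_pos_of_pos hr _).ne'
  have hsplit {w : ℝ} (hw : 0 < w) : w ^ (α + c - 1) = w ^ (α - 1) * w ^ c := by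
    rw [add_sub_right_comm, Real.rpow_add_natCast hw.ne']
  have hexp (w : ℝ) : Real.exp (-((τ + φ) * w)) = Real.exp (-τ * w) * Real.exp (-φ * w) := by
    rw [← Real.exp_add]
    ring_nf
  have hcongr : Set.EqOn
      (fun w : ℝ => gammaDensity (α + c) (τ + φ) w' *
        (Real.exp (-φ * w) * (φ * w) ^ c / Nat.factorial c) * gammaDensity α τ w)
      (fun w => gammaDensity (α + c) (τ + φ) w' * (φ ^ c / Nat.factorial c) *
        (τ ^ α / Real.Gamma α) * (w ^ (α + c - 1) * Real.exp (-((τ + φ) * w)))) (Set.Ioi 0) := by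
    intro w hw
    simp only [gammaDensity.eq_1 α τ w, hsplit hw, hexp w, mul_pow]
    ring
  rw [setIntegral_congr_fun measurableSet_Ioi hcongr, integral_const_mul,
    Real.integral_rpow_mul_exp_neg_mul_Ioi hαc hr, one_div, Real.inv_rpow hr.le]
  simp only [gammaDensity, neg_mul (τ + φ), hsplit hw', hexp w', mul_pow]
  field_simp

/-- Stationarity of the total-mass chain: if `w ~ Gam(α,τ)`, `c | w ~ Poisson(φ w)` and
`w' | c ~ Gam(α + c, τ + φ)`, then marginally `w' ~ Gam(α,τ)`; in terms of densities,
`∑_{c≥0} ∫_0^∞ f_{α+c, τ+φ}(w') · e^{-φ w} (φ w)^c / c! · f_{α,τ}(w) dw = f_{α,τ}(w')`. -/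
theorem total_mass_stationarity (α τ φ : ℝ) (hα : 0 < α) (hτ : 0 < τ) (hφ : 0 < φ)
    (w' : ℝ) (hw' : 0 < w') :
    ∑' c : ℕ, ∫ w in Set.Ioi (0 : ℝ),
        gammaDensity (α + c) (τ + φ) w' * (Real.exp (-φ * w) * (φ * w) ^ c / Nat.factorial c) *
          gammaDensity α τ w
      = gammaDensity α τ w' := by
  simp only [integral_gammaDensity_mul_poisson hα hτ hφ hw']
  have hsum : HasSum (fun c : ℕ => (φ * w') ^ c / Nat.factorial c) (Real.exp (φ * w')) := by
    rw [Real.exp_eq_exp_ℝ]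
    exact NormedSpace.expSeries_div_hasSum_exp (φ * w')
  rw [(hsum.mul_left _).tsum_eq, mul_assoc, ← Real.exp_add]
  simp
end

section
/- Fix τ > 0, an integer t ≥ 2, and dependence parameters φ_1, …, φ_{t−1} > 0. Consider the Markov chain (w_1, …, w_t) on [0,∞) defined by: w_1 = w > 0, and for s = 1, …, t−1, given w_s, draw c_s ~ Poisson(φ_s w_s) and then w_{s+1} | c_s ~ Gam(c_s, φ_s + τ), where Gam(0, b) is the point mass at 0. Define y_{t|s} for s = t−1, t−2, …, 1 by the backward recurrence y_{t|t−1} = φ_{t−1} and y_{t|s−1} = y_{t|s}·φ_{s−1}/(φ_{s−1} + τ + y_{t|s}). Then P(w_t = 0) = exp(−y_{t|1}·w). -/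
open MeasureTheory ProbabilityTheory

/-- One step of the Pitt–Walker transition for the mass of a single atom: given the current
mass `x`, draw `c ~ Poisson(φ x)` and then the new mass from `Gam(c, φ + τ)`, where
`Gam(0, ·)` is the point mass at `0`. -/
noncomputable def pittWalkerStep (φ τ : ℝ) (x : ℝ) : Measure ℝ :=
  ((poissonPMF (Real.toNNReal (φ * x))).toMeasure).bind
    (fun c => if c = 0 then Measure.dirac 0 else gammaMeasure c (φ + τ))

set_option linter.deprecated false

/-- The probability generating function of the Poisson distribution. -/
lemma tsum_pow_mul_poissonPMF (r : NNReal) {q : ℝ} (hq : 0 ≤ q) :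
    ∑' n : ℕ, ENNReal.ofReal (q ^ n) * poissonPMF r n =
      ENNReal.ofReal (Real.exp (-(r * (1 - q)))) := by
  have h : HasSum (fun n : ℕ => q ^ n * poissonPMFReal r n) (Real.exp (-(r * (1 - q)))) := by
    have h' := (NormedSpace.expSeries_div_hasSum_exp (r * q : ℝ)).mul_left (Real.exp (-r))
    rw [← Real.exp_eq_exp_ℝ, ← Real.exp_add] at h'
    convert! h' using 1
    · funext n
      rw [poissonPMFReal, mul_pow]
      ring
    · ring_nf
  rw [← h.tsum_eq, ENNReal.ofReal_tsum_of_nonneg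
    (fun n => mul_nonneg (pow_nonneg hq n) poissonPMFReal_nonneg) h.summable]
  refine tsum_congr fun n => ?_
  rw [ENNReal.ofReal_mul (pow_nonneg hq n), poissonPMFReal_ofReal_eq_poissonPMF]

/-- The Laplace transform of the Gamma distribution. -/
lemma lintegral_exp_neg_mul_gammaMeasure {a b y : ℝ} (ha : 0 < a) (hb : 0 < b) (hy : 0 ≤ y) :
    ∫⁻ x, ENNReal.ofReal (Real.exp (-(y * max x 0))) ∂(gammaMeasure a b) =
      ENNReal.ofReal ((b / (b + y)) ^ a) := by
  have hby : 0 < b + y := by positivity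
  have hm : ∀ r, Measurable (gammaPDF a r) :=
    fun r => (measurable_gammaPDFReal a r).ennreal_ofReal
  rw [gammaMeasure, lintegral_withDensity_eq_lintegral_mul _ (hm b) (by fun_prop)]
  have h : ∀ x, (gammaPDF a b * fun x => ENNReal.ofReal (Real.exp (-(y * max x 0)))) x =
      ENNReal.ofReal ((b / (b + y)) ^ a) * gammaPDF a (b + y) x := by
    intro x
    rw [Pi.mul_apply]
    rcases lt_or_ge x 0 with hx | hx
    · simp [gammaPDF_of_neg hx]
    · rw [gammaPDF_of_nonneg hx, gammaPDF_of_nonneg hx, max_eq_left hx,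
        ← ENNReal.ofReal_mul' (by positivity), ← ENNReal.ofReal_mul (by positivity),
        Real.div_rpow hb.le hby.le,
        show -((b + y) * x) = -(b * x) + -(y * x) by ring, Real.exp_add]
      have : (b + y) ^ a ≠ 0 := (Real.rpow_pos_of_pos hby a).ne'
      congr 1
      field_simp
  simp_rw [h]
  rw [lintegral_const_mul _ (hm _), lintegral_gammaPDF_eq_one ha hby, mul_one]

lemma measurable_pittWalkerStep (φ τ : ℝ) : Measurable (pittWalkerStep φ τ) := by
  refine Measure.measurable_of_measurable_coe _ fun s hs => ?_
  simp_rw [pittWalkerStep, Measure.bind_apply hs (measurable_of_countable _).aemeasurable,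
    lintegral_countable', PMF.toMeasure_apply_singleton _ _ (measurableSet_singleton _),
    ← poissonPMFReal_ofReal_eq_poissonPMF, poissonPMFReal]
  fun_prop

lemma pittWalkerStep_singleton_zero (φ τ x : ℝ) (hφ : 0 ≤ φ) :
    pittWalkerStep φ τ x {0} = ENNReal.ofReal (Real.exp (-(φ * max x 0))) := by
  rw [pittWalkerStep, Measure.bind_apply (measurableSet_singleton _)
    (measurable_of_countable _).aemeasurable, lintegral_countable']
  have h := tsum_pow_mul_poissonPMF (Real.toNNReal (φ * x)) le_rfl
  rw [Real.coe_toNNReal', sub_zero, mul_one] at h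
  rw [mul_max_of_nonneg _ _ hφ, mul_zero, ← h]
  refine tsum_congr fun n => ?_
  rw [PMF.toMeasure_apply_singleton _ _ (measurableSet_singleton _)]
  congr 1
  rcases eq_or_ne n 0 with rfl | hn
  · simp
  · rw [if_neg hn, zero_pow hn, ENNReal.ofReal_zero, gammaMeasure]
    exact withDensity_absolutelyContinuous _ _ Real.volume_singleton

lemma lintegral_exp_neg_mul_pittWalkerStep {φ τ y : ℝ} (x : ℝ) (hφ : 0 < φ) (hτ : 0 < τ)
    (hy : 0 ≤ y) :
    ∫⁻ z, ENNReal.ofReal (Real.exp (-(y * max z 0))) ∂(pittWalkerStep φ τ x) =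
      ENNReal.ofReal (Real.exp (-(y * φ / (φ + τ + y) * max x 0))) := by
  rw [pittWalkerStep, Measure.lintegral_bind (measurable_of_countable _).aemeasurable
    (by fun_prop), lintegral_countable']
  have h := tsum_pow_mul_poissonPMF (Real.toNNReal (φ * x))
    (q := (φ + τ) / (φ + τ + y)) (by positivity)
  have hexp : max (φ * x) 0 * (1 - (φ + τ) / (φ + τ + y)) = y * φ / (φ + τ + y) * max x 0 := by
    rw [← mul_zero φ, ← mul_max_of_nonneg _ _ hφ.le, mul_zero]
    field_simp
    ring
  rw [Real.coe_toNNReal', hexp] at h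
  rw [← h]
  refine tsum_congr fun n => ?_
  rw [PMF.toMeasure_apply_singleton _ _ (measurableSet_singleton _)]
  congr 1
  rcases eq_or_ne n 0 with rfl | hn
  · simp
  · rw [if_neg hn, lintegral_exp_neg_mul_gammaMeasure (by positivity) (by positivity) hy,
      Real.rpow_natCast]

/-- Proposition 4: death probability of an atom under the Pitt–Walker dynamics. If
`w_1 = w > 0` and, for `s = 1, …, t-1`, `w_{s+1}` is obtained from `w_s` by drawing
`c_s ~ Poisson(φ_s w_s)` and then `w_{s+1} | c_s ~ Gam(c_s, φ_s + τ)`, then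
`P(w_t = 0) = exp(-y_{t|1} w)`, where `y_{t|t-1} = φ_{t-1}` and
`y_{t|s-1} = y_{t|s} φ_{s-1} / (φ_{s-1} + τ + y_{t|s})`. -/
theorem atom_death_probability
    (τ : ℝ) (hτ : 0 < τ) (t : ℕ) (ht : 2 ≤ t)
    (φ : ℕ → ℝ) (hφ : ∀ s, 0 < φ s) (w : ℝ) (hw : 0 < w)
    (μ : ℕ → Measure ℝ) (hμ1 : μ 1 = Measure.dirac w)
    (hμ : ∀ s, 1 ≤ s → s ≤ t - 1 → μ (s + 1) = (μ s).bind (pittWalkerStep (φ s) τ))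
    (y : ℕ → ℝ) (hyt : y (t - 1) = φ (t - 1))
    (hy : ∀ s, 2 ≤ s → s ≤ t - 1 → y (s - 1) = y s * φ (s - 1) / (φ (s - 1) + τ + y s)) :
    μ t {0} = ENNReal.ofReal (Real.exp (-(y 1) * w)) := by
  have key : ∀ s, s ≤ t - 1 → 1 ≤ s → 0 ≤ y s ∧
      μ t {0} = ∫⁻ x, ENNReal.ofReal (Real.exp (-(y s * max x 0))) ∂(μ s) := by
    intro s hs
    induction hs using Nat.decreasingInduction with
    | self =>
      intro h1
      refine ⟨hyt ▸ (hφ _).le, ?_⟩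
      have h := hμ (t - 1) h1 le_rfl
      rw [Nat.sub_add_cancel (by lia)] at h
      rw [h, Measure.bind_apply (measurableSet_singleton _)
        (measurable_pittWalkerStep _ _).aemeasurable, hyt]
      simp_rw [pittWalkerStep_singleton_zero _ _ _ (hφ _).le]
    | of_succ s hs ih =>
      intro h1
      obtain ⟨hy0, ih⟩ := ih (by lia)
      have hys := hy (s + 1) (by lia) hs
      rw [Nat.add_sub_cancel] at hys
      have hφs := hφ s
      refine ⟨by rw [hys]; positivity, ?_⟩
      rw [ih, hμ s h1 hs.le, Measure.lintegral_bind
        (measurable_pittWalkerStep _ _).aemeasurable (by fun_prop), hys]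
      simp_rw [lintegral_exp_neg_mul_pittWalkerStep _ hφs hτ hy0]
  rw [(key 1 (by lia) le_rfl).2, hμ1, lintegral_dirac' _ (by fun_prop), max_eq_left hw.le,
    neg_mul]
end
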